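/- For the Besov-space criterion: let f¹(z) = ∑_{n≥0} f_{n+1} z^n with |f_n| = O(n^{-α}), α > 3/2, and let 1/(α-1/2) < q < 1. Then for any integers k₁, k₂ with k₁q > 1 and k₁ < (2α-2)/(2-q), setting k = k₁+k₂, the integral ∬_𝔻 (1-|z|²)^{k q} |f¹^{(k)}(z)|^q (1-|z|²)^{-2} dA is finite; in particular such k₁ exists since (2α-2)/(2-q) - 1/q > 0 if and only if q > 1/(α-1/2). -/

import Mathlib

/-!
STATEMENT 17: Besov-space criterion.  Let `f¹(z) = ∑_{n≥0} f_{n+1} z^n` with `|f_n| = O(n^{-α})`,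
`α > 3/2`, and `1/(α-1/2) < q < 1`.  Then for integers `k₁, k₂` with `k₁ q > 1` and
`k₁ < (2α-2)/(2-q)`, setting `k = k₁ + k₂`, the integral
`∬_𝔻 (1-|z|²)^{kq} |f¹⁽ᵏ⁾(z)|^q (1-|z|²)^{-2} dA` is finite; in particular such `k₁` exists,
since `(2α-2)/(2-q) - 1/q > 0` iff `q > 1/(α-1/2)`.
-/

open MeasureTheory

lemma integral_radial_mul_pow_mul_conj_pow_eq_zero (φ : ℝ → ℝ) {n m : ℕ} (h : n ≠ m) :
    ∫ z : ℂ, (φ ‖z‖ : ℂ) * (z ^ n * (starRingEnd ℂ) z ^ m) = 0 := by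
  set J : ℂ := ∫ z : ℂ, (φ ‖z‖ : ℂ) * (z ^ n * (starRingEnd ℂ) z ^ m) with hJ
  have hrot (t : ℝ) : J = Complex.exp (((n : ℝ) - m) * t * Complex.I) * J := by
    have hmp := (rotation (Circle.exp t)).measurePreserving
    have hcomp := hmp.integral_comp (rotation (Circle.exp t)).toHomeomorph.measurableEmbedding
      (fun z : ℂ => (φ ‖z‖ : ℂ) * (z ^ n * (starRingEnd ℂ) z ^ m))
    rw [← hJ] at hcomp
    conv_lhs => rw [← hcomp]
    rw [hJ, ← integral_const_mul]
    congr 1 with z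
    have h1 : (starRingEnd ℂ) (Complex.exp (t * Complex.I)) = Complex.exp (-(t * Complex.I)) := by
      rw [← Complex.exp_conj]; simp
    rw [LinearIsometryEquiv.norm_map]
    simp only [rotation_apply, Circle.coe_exp, map_mul, mul_pow, h1]
    rw [← Complex.exp_nat_mul, ← Complex.exp_nat_mul]
    have h2 : Complex.exp (((n : ℝ) - m) * t * Complex.I) =
        Complex.exp (n * (t * Complex.I)) * Complex.exp (m * (-(t * Complex.I))) := by
      rw [← Complex.exp_add]; congr 1; push_cast; ring
    rw [h2]; ring
  have hnm : ((n : ℂ) - m) ≠ 0 := sub_ne_zero.mpr (by exact_mod_cast h)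
  have h0 := hrot (Real.pi / ((n : ℝ) - m))
  have h1 : (((n : ℝ) - m) * (Real.pi / ((n : ℝ) - m) : ℝ) * Complex.I : ℂ) =
      Real.pi * Complex.I := by
    push_cast; field_simp
  rw [h1, Complex.exp_pi_mul_I] at h0
  have h2 : (2 : ℂ) * J = 0 := by linear_combination h0
  simpa using h2

/-- The radial profile of the weight `(1 - |z|²) ^ a` on the unit disk, extended by zero. -/
noncomputable def diskWeight (a : ℝ) : ℝ → ℝ :=
  Set.indicator (Set.Iio 1) fun r => (1 - r ^ 2) ^ a

lemma measurable_diskWeight (a : ℝ) : Measurable (diskWeight a) :=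
  Measurable.indicator (by fun_prop) measurableSet_Iio

lemma diskWeight_norm_nonneg (a : ℝ) (z : ℂ) : 0 ≤ diskWeight a ‖z‖ := by
  unfold diskWeight
  by_cases h : ‖z‖ < 1
  · rw [Set.indicator_of_mem (by exact h)]
    exact Real.rpow_nonneg (by nlinarith [norm_nonneg z]) _
  · rw [Set.indicator_of_notMem (by exact h)]

lemma diskWeight_mul_pow_le (a : ℝ) (n : ℕ) {y : ℝ} (hy : 0 < y) :
    y * (diskWeight a y * y ^ (2 * n)) ≤
      2 ^ |a| * (Set.Ioi 0).indicator
        (fun s : ℝ => s ^ a * Real.exp (-(((n : ℝ) + 1) * s))) (1 - y) := by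
  unfold diskWeight
  by_cases h : y < 1
  · rw [Set.indicator_of_mem (by exact h), Set.indicator_of_mem (by simpa using h)]
    have h1 : (1 - y ^ 2) ^ a ≤ 2 ^ |a| * (1 - y) ^ a := by
      rw [show 1 - y ^ 2 = (1 + y) * (1 - y) by ring,
        Real.mul_rpow (by linarith) (by linarith)]
      refine mul_le_mul_of_nonneg_right ?_ (Real.rpow_nonneg (by linarith) _)
      calc (1 + y) ^ a ≤ (1 + y) ^ |a| :=
            Real.rpow_le_rpow_of_exponent_le (by linarith) (le_abs_self a)
        _ ≤ 2 ^ |a| := Real.rpow_le_rpow (by linarith) (by linarith) (abs_nonneg a)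
    have h2 : y * y ^ (2 * n) ≤ Real.exp (-(((n : ℝ) + 1) * (1 - y))) := by
      calc y * y ^ (2 * n) = y ^ (2 * n + 1) := by ring
        _ ≤ y ^ (n + 1) := pow_le_pow_of_le_one hy.le h.le (by omega)
        _ ≤ Real.exp (-(1 - y)) ^ (n + 1) := by
            gcongr
            have := Real.add_one_le_exp (-(1 - y)); linarith
        _ = _ := by rw [← Real.exp_nat_mul]; congr 1; push_cast; ring
    calc y * ((1 - y ^ 2) ^ a * y ^ (2 * n)) = (1 - y ^ 2) ^ a * (y * y ^ (2 * n)) := by ring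
      _ ≤ (2 ^ |a| * (1 - y) ^ a) * Real.exp (-(((n : ℝ) + 1) * (1 - y))) := by
          have : 0 ≤ (1 - y) ^ a := Real.rpow_nonneg (by linarith) _
          gcongr
      _ = _ := by ring
  · rw [Set.indicator_of_notMem (by exact h), Set.indicator_of_notMem (by simpa using h)]
    simp

lemma integrable_diskWeight_mul_norm_pow {a : ℝ} (ha : -1 < a) (n : ℕ) :
    Integrable (fun z : ℂ => diskWeight a ‖z‖ * ‖z‖ ^ (2 * n)) ∧
      ∫ z : ℂ, diskWeight a ‖z‖ * ‖z‖ ^ (2 * n) ≤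
        2 * Real.pi * 2 ^ |a| * Real.Gamma (a + 1) * ((n : ℝ) + 1) ^ (-a - 1) := by
  set H : ℝ → ℝ :=
    (Set.Ioi 0).indicator (fun s : ℝ => s ^ a * Real.exp (-(((n : ℝ) + 1) * s))) with hH
  have hn : (0 : ℝ) < (n : ℝ) + 1 := by positivity
  have hHint : Integrable H := by
    rw [hH, integrable_indicator_iff measurableSet_Ioi]
    have := integrableOn_rpow_mul_exp_neg_mul_rpow ha one_pos hn
    simpa only [Real.rpow_one, neg_mul] using this
  have hHval : ∫ s, H s = (1 / ((n : ℝ) + 1)) ^ (a + 1) * Real.Gamma (a + 1) := by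
    rw [hH, integral_indicator measurableSet_Ioi,
      ← Real.integral_rpow_mul_exp_neg_mul_Ioi (by linarith) hn]
    simp
  have hKint : Integrable (fun y => 2 ^ |a| * H (1 - y)) :=
    (hHint.comp_sub_left 1).const_mul _
  have hle (y : ℝ) (hy : y ∈ Set.Ioi (0 : ℝ)) :
      y ^ (Module.finrank ℝ ℂ - 1) • (diskWeight a y * y ^ (2 * n)) ≤ 2 ^ |a| * H (1 - y) := by
    simpa using diskWeight_mul_pow_le a n hy
  have hnn (y : ℝ) (hy : y ∈ Set.Ioi (0 : ℝ)) :
      0 ≤ y ^ (Module.finrank ℝ ℂ - 1) • (diskWeight a y * y ^ (2 * n)) := by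
    have h1 := diskWeight_norm_nonneg a (y : ℂ)
    have hy : 0 < y := hy
    rw [Complex.norm_real, Real.norm_of_nonneg hy.le] at h1
    rw [smul_eq_mul]; positivity
  have hint : IntegrableOn
      (fun y : ℝ => y ^ (Module.finrank ℝ ℂ - 1) • (diskWeight a y * y ^ (2 * n)))
      (Set.Ioi 0) := by
    refine Integrable.mono' hKint.integrableOn ?_ ?_
    · have := measurable_diskWeight a
      exact Measurable.aestronglyMeasurable (by fun_prop)
    · filter_upwards [ae_restrict_mem measurableSet_Ioi] with y hy
      rw [Real.norm_of_nonneg (hnn y hy)]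
      exact hle y hy
  refine ⟨(integrable_fun_norm_addHaar volume
    (f := fun r : ℝ => diskWeight a r * r ^ (2 * n))).2 hint, ?_⟩
  rw [integral_fun_norm_addHaar volume (fun r : ℝ => diskWeight a r * r ^ (2 * n))]
  have hI : ∫ y in Set.Ioi (0 : ℝ),
      y ^ (Module.finrank ℝ ℂ - 1) • (diskWeight a y * y ^ (2 * n)) ≤
        2 ^ |a| * ((1 / ((n : ℝ) + 1)) ^ (a + 1) * Real.Gamma (a + 1)) := by
    calc _ ≤ ∫ y in Set.Ioi (0 : ℝ), 2 ^ |a| * H (1 - y) :=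
          setIntegral_mono_on hint hKint.integrableOn measurableSet_Ioi hle
      _ ≤ ∫ y, 2 ^ |a| * H (1 - y) := by
          refine setIntegral_le_integral hKint (Filter.Eventually.of_forall fun y => ?_)
          refine mul_nonneg (by positivity) (Set.indicator_nonneg (fun s hs => ?_) _)
          exact mul_nonneg (Real.rpow_nonneg (le_of_lt hs) _) (Real.exp_pos _).le
      _ = _ := by rw [integral_const_mul, integral_sub_left_eq_self H volume 1, hHval]
  have hvol : (volume : Measure ℂ).real (Metric.ball 0 1) = Real.pi := by
    simp [Measure.real, Complex.volume_ball]
  have hpow : ((n : ℝ) + 1) ^ (-a - 1) = (1 / ((n : ℝ) + 1)) ^ (a + 1) := by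
    rw [one_div, Real.inv_rpow hn.le, ← Real.rpow_neg hn.le]; congr 1; ring
  rw [hvol, hpow, Complex.finrank_real_complex, nsmul_eq_mul, smul_eq_mul]
  rw [Complex.finrank_real_complex] at hI
  have := mul_le_mul_of_nonneg_left hI (by positivity : 0 ≤ 2 * Real.pi)
  push_cast
  linarith

lemma integral_radial_mul_norm_sq_sum (φ : ℝ → ℝ) (hφ : Measurable φ)
    (hφ0 : ∀ z : ℂ, 0 ≤ φ ‖z‖)
    (hI : ∀ n : ℕ, Integrable fun z : ℂ => φ ‖z‖ * ‖z‖ ^ (2 * n)) (c : ℕ → ℂ) (N : ℕ) :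
    Integrable (fun z : ℂ => φ ‖z‖ * ‖∑ n ∈ Finset.range N, c n * z ^ n‖ ^ 2) ∧
      ∫ z : ℂ, φ ‖z‖ * ‖∑ n ∈ Finset.range N, c n * z ^ n‖ ^ 2 =
        ∑ n ∈ Finset.range N, ‖c n‖ ^ 2 * ∫ z : ℂ, φ ‖z‖ * ‖z‖ ^ (2 * n) := by
  have hterm (n m : ℕ) :
      Integrable fun z : ℂ => (φ ‖z‖ : ℂ) * (z ^ n * (starRingEnd ℂ) z ^ m) := by
    refine Integrable.mono' ((hI n).add (hI m)) (Measurable.aestronglyMeasurable ?_)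
      (Filter.Eventually.of_forall fun z => ?_)
    · have : Measurable (starRingEnd ℂ : ℂ → ℂ) := Complex.continuous_conj.measurable
      fun_prop
    · simp only [norm_mul, norm_pow, RCLike.norm_conj, Complex.norm_real,
        Real.norm_of_nonneg (hφ0 z), Pi.add_apply]
      rw [← mul_add]
      refine mul_le_mul_of_nonneg_left ?_ (hφ0 z)
      rw [mul_comm 2 n, mul_comm 2 m, pow_mul, pow_mul]
      nlinarith [sq_nonneg (‖z‖ ^ n - ‖z‖ ^ m), sq_nonneg (‖z‖ ^ n + ‖z‖ ^ m)]
  have hexp (z : ℂ) : ((φ ‖z‖ * ‖∑ n ∈ Finset.range N, c n * z ^ n‖ ^ 2 : ℝ) : ℂ) =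
      ∑ n ∈ Finset.range N, ∑ m ∈ Finset.range N, (c n * (starRingEnd ℂ) (c m)) *
        ((φ ‖z‖ : ℂ) * (z ^ n * (starRingEnd ℂ) z ^ m)) := by
    push_cast
    rw [← Complex.mul_conj', map_sum, Finset.sum_mul_sum, Finset.mul_sum]
    refine Finset.sum_congr rfl fun n _ => ?_
    rw [Finset.mul_sum]
    refine Finset.sum_congr rfl fun m _ => ?_
    rw [map_mul, map_pow]; ring
  have hintC : Integrable fun z : ℂ =>
      ((φ ‖z‖ * ‖∑ n ∈ Finset.range N, c n * z ^ n‖ ^ 2 : ℝ) : ℂ) := by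
    simp_rw [hexp]
    exact integrable_finsetSum _ fun n _ => integrable_finsetSum _ fun m _ =>
      (hterm n m).const_mul _
  refine ⟨by simpa only [RCLike.re_to_complex, Complex.ofReal_re] using hintC.re, ?_⟩
  apply Complex.ofReal_injective
  rw [← integral_complex_ofReal]
  simp_rw [hexp]
  rw [integral_finsetSum _ fun n _ => integrable_finsetSum _ fun m _ => (hterm n m).const_mul _]
  push_cast
  refine Finset.sum_congr rfl fun n hn => ?_
  rw [integral_finsetSum _ fun m _ => (hterm n m).const_mul _, Finset.sum_eq_single n]
  · rw [integral_const_mul, Complex.mul_conj', ← integral_complex_ofReal]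
    congr 2 with z
    push_cast
    rw [pow_mul, ← Complex.mul_conj', mul_pow]
  · intro m _ hmn
    rw [integral_const_mul, integral_radial_mul_pow_mul_conj_pow_eq_zero φ hmn.symm, mul_zero]
  · intro h; exact absurd hn h

lemma integrable_radial_mul_norm_sq_of_hasSum (φ : ℝ → ℝ) (hφ : Measurable φ)
    (hφ0 : ∀ z : ℂ, 0 ≤ φ ‖z‖)
    (hI : ∀ n : ℕ, Integrable fun z : ℂ => φ ‖z‖ * ‖z‖ ^ (2 * n)) (c : ℕ → ℂ)
    (hc : Summable fun n => ‖c n‖ ^ 2 * ∫ z : ℂ, φ ‖z‖ * ‖z‖ ^ (2 * n)) (g : ℂ → ℂ)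
    (hg : ∀ z : ℂ, φ ‖z‖ ≠ 0 → HasSum (fun n => c n * z ^ n) (g z)) :
    Integrable fun z : ℂ => φ ‖z‖ * ‖g z‖ ^ 2 := by
  have hlim (z : ℂ) : Filter.Tendsto
      (fun N => φ ‖z‖ * ‖∑ n ∈ Finset.range N, c n * z ^ n‖ ^ 2) Filter.atTop
      (nhds (φ ‖z‖ * ‖g z‖ ^ 2)) := by
    by_cases h : φ ‖z‖ = 0
    · simp [h]
    · exact (((hg z h).tendsto_sum_nat.norm.pow 2).const_mul _)
  have hmeas (N : ℕ) :
      Measurable fun z : ℂ => φ ‖z‖ * ‖∑ n ∈ Finset.range N, c n * z ^ n‖ ^ 2 := by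
    fun_prop
  refine ⟨(measurable_of_tendsto_metrizable hmeas
    (tendsto_pi_nhds.2 hlim)).aestronglyMeasurable, ?_⟩
  rw [hasFiniteIntegral_iff_ofReal
    (Filter.Eventually.of_forall fun z => mul_nonneg (hφ0 z) (by positivity))]
  calc ∫⁻ z : ℂ, ENNReal.ofReal (φ ‖z‖ * ‖g z‖ ^ 2)
      = ∫⁻ z : ℂ, Filter.liminf (fun N => ENNReal.ofReal
          (φ ‖z‖ * ‖∑ n ∈ Finset.range N, c n * z ^ n‖ ^ 2)) Filter.atTop := by
        congr 1 with z
        exact ((ENNReal.continuous_ofReal.tendsto _).comp (hlim z)).liminf_eq.symm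
    _ ≤ Filter.liminf (fun N => ∫⁻ z : ℂ, ENNReal.ofReal
          (φ ‖z‖ * ‖∑ n ∈ Finset.range N, c n * z ^ n‖ ^ 2)) Filter.atTop :=
        lintegral_liminf_le fun N => (hmeas N).ennreal_ofReal
    _ ≤ ENNReal.ofReal (∑' n, ‖c n‖ ^ 2 * ∫ z : ℂ, φ ‖z‖ * ‖z‖ ^ (2 * n)) := by
        refine Filter.liminf_le_of_le (by isBoundedDefault) fun b hb => ?_
        obtain ⟨N, hN⟩ := hb.exists
        refine hN.trans ?_
        obtain ⟨h1, h2⟩ := integral_radial_mul_norm_sq_sum φ hφ hφ0 hI c N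
        rw [← ofReal_integral_eq_lintegral_ofReal h1
          (Filter.Eventually.of_forall fun z => mul_nonneg (hφ0 z) (by positivity)), h2]
        refine ENNReal.ofReal_le_ofReal (hc.sum_le_tsum _ fun n _ => ?_)
        exact mul_nonneg (by positivity)
          (integral_nonneg fun z => mul_nonneg (hφ0 z) (by positivity))
    _ < ⊤ := ENNReal.ofReal_lt_top

lemma hasFPowerSeriesOnBall_tsum_of_bound {c : ℕ → ℂ}
    (hc : ∀ r : NNReal, r < 1 → Summable fun n => ‖c n‖ * (r : ℝ) ^ n) :
    HasFPowerSeriesOnBall (fun w : ℂ => ∑' n : ℕ, c n * w ^ n)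
      (FormalMultilinearSeries.ofScalars ℂ c) 0 1 := by
  have hrad : 1 ≤ (FormalMultilinearSeries.ofScalars ℂ c).radius := by
    refine ENNReal.le_of_forall_nnreal_lt fun r hr => ?_
    apply FormalMultilinearSeries.le_radius_of_summable
    simpa only [FormalMultilinearSeries.ofScalars_norm] using hc r (by exact_mod_cast hr)
  have h := (FormalMultilinearSeries.hasFPowerSeriesOnBall
    (FormalMultilinearSeries.ofScalars ℂ c) (zero_lt_one.trans_le hrad)).mono zero_lt_one hrad
  refine h.congr fun z _ => ?_
  simp [FormalMultilinearSeries.sum, mul_comm]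

lemma hasSum_iteratedDeriv_tsum {c : ℕ → ℂ}
    (hc : ∀ r : NNReal, r < 1 → Summable fun n => ‖c n‖ * (r : ℝ) ^ n) (k : ℕ) {z : ℂ}
    (hz : ‖z‖ < 1) :
    HasSum (fun n => (((n + k).descFactorial k : ℕ) * c (n + k)) * z ^ n)
      (iteratedDeriv k (fun w : ℂ => ∑' n : ℕ, c n * w ^ n) z) := by
  have hps := hasFPowerSeriesOnBall_tsum_of_bound hc
  set F : ℂ → ℂ := fun w => ∑' n : ℕ, c n * w ^ n with hF
  have hball : Metric.eball (0 : ℂ) 1 = Metric.ball 0 1 := by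
    rw [← ENNReal.ofReal_one, Metric.eball_ofReal]
  have han : AnalyticOnNhd ℂ F (Metric.ball 0 1) := hball ▸ hps.analyticOnNhd
  have hder (n : ℕ) : iteratedDeriv n F 0 = n.factorial * c n := by
    rw [iteratedDeriv_eq_iteratedFDeriv, ← hps.factorial_smul 1 n]
    simp
  have hdiff : DifferentiableOn ℂ (iteratedDeriv k F) (Metric.ball 0 1) := by
    rw [iteratedDeriv_eq_iterate]
    exact (han.iterated_deriv k).differentiableOn
  have h := Complex.hasSum_taylorSeries_on_ball hdiff (z := z) (by simpa using hz)
  suffices heq : ∀ n : ℕ, ((n + k).descFactorial k : ℕ) * c (n + k) * z ^ n =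
      (n.factorial : ℂ)⁻¹ • (z - 0) ^ n • iteratedDeriv n (iteratedDeriv k F) 0 by
    rw [funext heq]
    exact h
  intro n
  have hit : iteratedDeriv n (iteratedDeriv k F) 0 = iteratedDeriv (n + k) F 0 := by
    simp only [iteratedDeriv_eq_iterate, Function.iterate_add_apply]
  have hfac : ((n.factorial : ℂ)) * ((n + k).descFactorial k : ℕ) = (n + k).factorial := by
    have := Nat.factorial_mul_descFactorial (Nat.le_add_left k n)
    rw [Nat.add_sub_cancel] at this
    exact_mod_cast this
  have hn0 : (n.factorial : ℂ) ≠ 0 := by exact_mod_cast n.factorial_ne_zero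
  rw [hit, hder, ← hfac, smul_eq_mul, smul_eq_mul, sub_zero]
  field_simp

lemma norm_descFactorial_mul_le {f : ℕ → ℂ} {α C₀ : ℝ} (hα : 0 ≤ α)
    (hf : ∀ n : ℕ, 1 ≤ n → ‖f n‖ ≤ C₀ * (n : ℝ) ^ (-α)) (k n : ℕ) :
    ‖(((n + k).descFactorial k : ℕ) : ℂ) * f (n + k + 1)‖ ≤
      (((k : ℝ) + 1) ^ k * C₀) * ((n : ℝ) + 1) ^ ((k : ℝ) - α) := by
  have hC₀ : 0 ≤ C₀ := by simpa using (norm_nonneg _).trans (hf 1 le_rfl)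
  have hn : (0 : ℝ) < (n : ℝ) + 1 := by positivity
  have h1 : (((n + k).descFactorial k : ℕ) : ℝ) ≤ (((k : ℝ) + 1) * ((n : ℝ) + 1)) ^ k := by
    calc (((n + k).descFactorial k : ℕ) : ℝ) ≤ (((n + k) ^ k : ℕ) : ℝ) := by
          exact_mod_cast Nat.descFactorial_le_pow _ _
      _ = ((n : ℝ) + k) ^ k := by push_cast; rfl
      _ ≤ _ := by
          gcongr
          nlinarith [mul_nonneg (Nat.cast_nonneg (α := ℝ) k) (Nat.cast_nonneg (α := ℝ) n)]
  have h2 : ‖f (n + k + 1)‖ ≤ C₀ * ((n : ℝ) + 1) ^ (-α) := by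
    refine (hf (n + k + 1) (by omega)).trans (mul_le_mul_of_nonneg_left ?_ hC₀)
    refine Real.rpow_le_rpow_of_nonpos hn ?_ (by linarith)
    push_cast
    linarith [Nat.cast_nonneg (α := ℝ) k]
  rw [norm_mul, Complex.norm_natCast]
  calc _ ≤ (((k : ℝ) + 1) * ((n : ℝ) + 1)) ^ k * (C₀ * ((n : ℝ) + 1) ^ (-α)) := by gcongr
    _ = _ := by
      rw [sub_eq_add_neg, Real.rpow_add hn, Real.rpow_natCast, mul_pow]; ring

lemma integrable_diskWeight_mul_norm_sq_iteratedDeriv {f : ℕ → ℂ} {α C₀ a : ℝ} (hα : 0 ≤ α)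
    (hf : ∀ n : ℕ, 1 ≤ n → ‖f n‖ ≤ C₀ * (n : ℝ) ^ (-α)) (k : ℕ) (ha : -1 < a)
    (hak : 2 * ((k : ℝ) - α) < a) :
    Integrable fun z : ℂ => diskWeight a ‖z‖ *
      ‖iteratedDeriv k (fun w : ℂ => ∑' n : ℕ, f (n + 1) * w ^ n) z‖ ^ 2 := by
  have hC₀ : 0 ≤ C₀ := by simpa using (norm_nonneg _).trans (hf 1 le_rfl)
  have hsum (r : NNReal) (hr : r < 1) : Summable fun n => ‖f (n + 1)‖ * (r : ℝ) ^ n := by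
    have hr' : (r : ℝ) < 1 := by exact_mod_cast hr
    refine Summable.of_nonneg_of_le (fun n => by positivity) (fun n => ?_)
      ((summable_geometric_of_lt_one r.2 hr').mul_left C₀)
    refine mul_le_mul_of_nonneg_right ((hf (n + 1) (by omega)).trans ?_) (by positivity)
    refine mul_le_of_le_one_right hC₀ (Real.rpow_le_one_of_one_le_of_nonpos ?_ (by linarith))
    push_cast
    linarith [Nat.cast_nonneg (α := ℝ) n]
  refine integrable_radial_mul_norm_sq_of_hasSum (diskWeight a) (measurable_diskWeight a)
    (diskWeight_norm_nonneg a) (fun n => (integrable_diskWeight_mul_norm_pow ha n).1)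
    (fun n => ((n + k).descFactorial k : ℕ) * f (n + k + 1)) ?_ _ fun z hz => ?_
  · set D : ℝ := (((k : ℝ) + 1) ^ k * C₀) with hD
    set E : ℝ := 2 * Real.pi * 2 ^ |a| * Real.Gamma (a + 1) with hE
    have hs : Summable fun n : ℕ => (D ^ 2 * E) * ((n : ℝ) + 1) ^ (2 * ((k : ℝ) - α) - a - 1) := by
      refine Summable.mul_left _ ?_
      have := (summable_nat_add_iff 1).2
        (Real.summable_nat_rpow (p := 2 * ((k : ℝ) - α) - a - 1).2 (by linarith))
      simpa using this
    refine Summable.of_nonneg_of_le (fun n => ?_) (fun n => ?_) hs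
    · exact mul_nonneg (by positivity)
        (integral_nonneg fun z => mul_nonneg (diskWeight_norm_nonneg a z) (by positivity))
    · have hn : (0 : ℝ) < (n : ℝ) + 1 := by positivity
      have h1 := norm_descFactorial_mul_le hα hf k n
      have h2 := (integrable_diskWeight_mul_norm_pow ha n).2
      calc _ ≤ (D * ((n : ℝ) + 1) ^ ((k : ℝ) - α)) ^ 2 * (E * ((n : ℝ) + 1) ^ (-a - 1)) := by
            refine mul_le_mul (pow_le_pow_left₀ (norm_nonneg _) h1 2) h2 ?_ (by positivity)
            exact integral_nonneg fun z => mul_nonneg (diskWeight_norm_nonneg a z) (by positivity)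
        _ = (D ^ 2 * E) * (((n : ℝ) + 1) ^ ((k : ℝ) - α) * ((n : ℝ) + 1) ^ ((k : ℝ) - α) *
              ((n : ℝ) + 1) ^ (-a - 1)) := by ring
        _ = _ := by
            rw [← Real.rpow_add hn, ← Real.rpow_add hn]; congr 2; ring
  · have hz1 : ‖z‖ < 1 := by
      by_contra h
      exact hz (Set.indicator_of_notMem (by simpa using h) _)
    exact hasSum_iteratedDeriv_tsum hsum k hz1

theorem besov_integral_finite (f : ℕ → ℂ) (α C₀ q : ℝ) (hα : 3 / 2 < α)
    (hf : ∀ n : ℕ, 1 ≤ n → ‖f n‖ ≤ C₀ * (n : ℝ) ^ (-α))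
    (hq1 : 1 / (α - 1 / 2) < q) (hq2 : q < 1)
    (k₁ k₂ : ℕ) (hk₁q : 1 < (k₁ : ℝ) * q) (hk₁ : (k₁ : ℝ) < (2 * α - 2) / (2 - q)) :
    IntegrableOn
      (fun z : ℂ => (1 - ‖z‖ ^ 2) ^ (((k₁ + k₂ : ℕ) : ℝ) * q - 2) *
        ‖iteratedDeriv (k₁ + k₂) (fun w : ℂ => ∑' n : ℕ, f (n + 1) * w ^ n) z‖ ^ q)
      (Metric.ball (0 : ℂ) 1) volume ∧
    (∃ m : ℕ, 1 < (m : ℝ) * q ∧ (m : ℝ) < (2 * α - 2) / (2 - q)) ∧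
    (0 < (2 * α - 2) / (2 - q) - 1 / q ↔ 1 / (α - 1 / 2) < q) := by
  have hα' : 0 < α - 1 / 2 := by linarith
  have hq0 : 0 < q := (by positivity : (0 : ℝ) < 1 / (α - 1 / 2)).trans hq1
  refine ⟨?_, ⟨k₁, hk₁q, hk₁⟩, ?_⟩
  · set k := k₁ + k₂ with hk
    set g : ℂ → ℂ := iteratedDeriv k (fun w : ℂ => ∑' n : ℕ, f (n + 1) * w ^ n) with hg
    have hkq : 1 < (k : ℝ) * q := by
      rw [hk]; push_cast
      nlinarith [mul_nonneg (Nat.cast_nonneg (α := ℝ) k₂) hq0.le]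
    have hinv : 1 / q < α - 1 / 2 := by
      rw [div_lt_iff₀ hα'] at hq1
      rw [div_lt_iff₀ hq0]; linarith
    have hkinv : 1 / q < k := by rwa [div_lt_iff₀ hq0]
    obtain ⟨a, ha, ha2⟩ : ∃ a : ℝ, max (-1) (2 * ((k : ℝ) - α)) < a ∧ a < 2 * k - 1 - 2 * (1 / q) :=
      exists_between (max_lt (by linarith) (by linarith))
    obtain ⟨ha1, hak⟩ := max_lt_iff.1 ha
    set b : ℝ := (k * q - 2 - a * (q / 2)) / (1 - q / 2) with hb
    have hb1 : -1 < b := by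
      rw [hb, lt_div_iff₀ (by linarith)]
      have h1 := mul_lt_mul_of_pos_right ha2 hq0
      have h2 : (2 * (k : ℝ) - 1 - 2 * (1 / q)) * q = 2 * k * q - q - 2 := by
        field_simp
      linarith
    have hbeq : a * (q / 2) + b * (1 - q / 2) = k * q - 2 := by
      rw [hb, div_mul_cancel₀ _ (by linarith)]; ring
    have hA := integrable_diskWeight_mul_norm_sq_iteratedDeriv (by linarith) hf k ha1 hak
    have hB : Integrable fun z : ℂ => diskWeight b ‖z‖ := by
      simpa using (integrable_diskWeight_mul_norm_pow hb1 0).1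
    rw [← hg] at hA
    have hgm : Measurable g := by
      have hk0 : k ≠ 0 := by rintro h; rw [h] at hkq; norm_num at hkq
      obtain ⟨j, hj⟩ := Nat.exists_eq_succ_of_ne_zero hk0
      rw [hg, hj, iteratedDeriv_succ]
      exact measurable_deriv _
    refine Integrable.mono' (hA.add hB).integrableOn
      (Measurable.aestronglyMeasurable (by fun_prop)) ?_
    filter_upwards [ae_restrict_mem measurableSet_ball] with z hz
    have hz1 : ‖z‖ < 1 := by simpa using hz
    have hw : 0 < 1 - ‖z‖ ^ 2 := by nlinarith [norm_nonneg z]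
    have hwt (s : ℝ) : diskWeight s ‖z‖ = (1 - ‖z‖ ^ 2) ^ s := Set.indicator_of_mem (Set.mem_Iio.2 hz1) _
    have hX : 0 ≤ (1 - ‖z‖ ^ 2) ^ a * ‖g z‖ ^ 2 :=
      mul_nonneg (Real.rpow_nonneg hw.le _) (by positivity)
    have hY : 0 ≤ (1 - ‖z‖ ^ 2) ^ b := Real.rpow_nonneg hw.le _
    rw [Real.norm_of_nonneg (mul_nonneg (Real.rpow_nonneg hw.le _) (by positivity)),
      Pi.add_apply, hwt, hwt]
    calc (1 - ‖z‖ ^ 2) ^ ((k : ℝ) * q - 2) * ‖g z‖ ^ q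
        = ((1 - ‖z‖ ^ 2) ^ a * ‖g z‖ ^ 2) ^ (q / 2) * ((1 - ‖z‖ ^ 2) ^ b) ^ (1 - q / 2) := by
          rw [Real.mul_rpow (Real.rpow_nonneg hw.le _) (by positivity), ← Real.rpow_mul hw.le,
            ← Real.rpow_mul hw.le, ← Real.rpow_natCast, ← Real.rpow_natCast, ← Real.rpow_mul
            (norm_nonneg _), ← hbeq, Real.rpow_add (by simpa using hw)]
          push_cast
          rw [mul_div_cancel₀ q two_ne_zero]
          ring
      _ ≤ q / 2 * ((1 - ‖z‖ ^ 2) ^ a * ‖g z‖ ^ 2) + (1 - q / 2) * (1 - ‖z‖ ^ 2) ^ b :=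
          Real.geom_mean_le_arith_mean2_weighted (by linarith) (by linarith) hX hY (by ring)
      _ ≤ _ := by
          refine add_le_add (mul_le_of_le_one_left hX (by linarith))
            (mul_le_of_le_one_left hY (by linarith))
  · rw [sub_pos, div_lt_div_iff₀ hq0 (by linarith), div_lt_iff₀ hα']
    constructor <;> intro h <;> nlinarith
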